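/- arXiv:1106.2913 — 3 statements merged into one kernel-verified Lean document; each statement's English description precedes it below -/
import Mathlib

section
/- Let n_1,…,n_m ∈ ℝ^n and let Δ = Δ(k⁰) be a Delzant polytope. Then there exists a real polynomial P in m variables, homogeneous of degree n, such that the Lebesgue volume of Δ(k) equals P(k_1,…,k_m) for every k ∈ C_Δ. -/
open MeasureTheory

noncomputable section

/-- Euclidean inner product on ℝⁿ. -/
def dot {n : ℕ} (x y : Fin n → ℝ) : ℝ := ∑ i, x i * y i

/-- The polytope `Δ(k) = ⋂_j {x : ⟨x, n_j⟩ ≤ k_j}` determined by conormals `N` and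
support numbers `k`. -/
def PolyDelta {n m : ℕ} (N : Fin m → Fin n → ℝ) (k : Fin m → ℝ) : Set (Fin n → ℝ) :=
  {x | ∀ j, dot x (N j) ≤ k j}

/-- The facet `F_j(k) = Δ(k) ∩ {x : ⟨x, n_j⟩ = k_j}`. -/
def PolyFacet {n m : ℕ} (N : Fin m → Fin n → ℝ) (k : Fin m → ℝ) (j : Fin m) :
    Set (Fin n → ℝ) :=
  {x ∈ PolyDelta N k | dot x (N j) = k j}

/-- The chamber of the polytope `Δ(k⁰)`: those `k` for which the combinatorics of the
facets of `Δ(k)` agrees with that of `Δ(k⁰)`. -/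
def chamber {n m : ℕ} (N : Fin m → Fin n → ℝ) (k0 : Fin m → ℝ) : Set (Fin m → ℝ) :=
  {k | ∀ J : Finset (Fin m),
    (⋂ j ∈ J, PolyFacet N k j).Nonempty ↔ (⋂ j ∈ J, PolyFacet N k0 j).Nonempty}

/-- Center of mass of a subset of ℝⁿ: `Cm(K) = (∫_K x dx)/(∫_K 1 dx)`. -/
def Cm {n : ℕ} (K : Set (Fin n → ℝ)) : Fin n → ℝ :=
  (∫ x in K, (1 : ℝ))⁻¹ • ∫ x in K, x

/-- `(Δ(k⁰), b)` is a mass linear pair: `⟨Cm(Δ(k)), b⟩` is an (affine) linear function of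
`k` on the chamber of `Δ(k⁰)`. -/
def IsMassLinear {n m : ℕ} (N : Fin m → Fin n → ℝ) (k0 : Fin m → ℝ) (b : Fin n → ℝ) :
    Prop :=
  ∃ (R : Fin m → ℝ) (C : ℝ), ∀ k ∈ chamber N k0,
    dot (Cm (PolyDelta N k)) b = (∑ j, R j * k j) + C

/-- `Δ(k)` is a Delzant polytope: each conormal is a primitive integer vector, exactly `n`
facets meet at each vertex, and the conormals of the facets through any vertex form a
ℤ-basis of ℤⁿ (an integer matrix of determinant ±1). -/
def IsDelzant {n m : ℕ} (N : Fin m → Fin n → ℝ) (k : Fin m → ℝ) : Prop :=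
  (∀ j, ∃ z : Fin n → ℤ, (∀ i, N j i = (z i : ℝ)) ∧ Finset.univ.gcd z = 1) ∧
  ∀ v ∈ Set.extremePoints ℝ (PolyDelta N k),
    ∃ J : Finset (Fin m), J.card = n ∧ (∀ j, j ∈ J ↔ dot v (N j) = k j) ∧
      ∃ e : Fin n → Fin m, (∀ i, e i ∈ J) ∧ Function.Injective e ∧
        |(Matrix.of fun i i' => N (e i) i').det| = 1


lemma dot_add_l {n : ℕ} (x y z : Fin n → ℝ) : dot (x + y) z = dot x z + dot y z := by
  simp [dot, add_mul, Finset.sum_add_distrib]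

lemma dot_sub_l {n : ℕ} (x y z : Fin n → ℝ) : dot (x - y) z = dot x z - dot y z := by
  simp [dot, sub_mul, Finset.sum_sub_distrib]

lemma dot_smul_l {n : ℕ} (c : ℝ) (x z : Fin n → ℝ) : dot (c • x) z = c * dot x z := by
  simp [dot, Finset.mul_sum, mul_assoc]

lemma dot_sum_l {n : ℕ} {ι : Type*} (s : Finset ι) (x : ι → Fin n → ℝ) (z : Fin n → ℝ) :
    dot (∑ i ∈ s, x i) z = ∑ i ∈ s, dot (x i) z := by
  simp only [dot, Finset.sum_apply, Finset.sum_mul]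
  rw [Finset.sum_comm]

/-- prefix set of a sequence -/
def pre {n m : ℕ} (f : Fin n → Fin m) (l : ℕ) : Finset (Fin m) :=
  (Finset.univ.filter fun i : Fin n => (i : ℕ) < l).image f

lemma mem_pre {n m : ℕ} {f : Fin n → Fin m} {l : ℕ} {j : Fin m} :
    j ∈ pre f l ↔ ∃ i : Fin n, (i : ℕ) < l ∧ f i = j := by
  simp [pre]

lemma pre_congr {n m : ℕ} {f g : Fin n → Fin m} {l : ℕ}
    (h : ∀ i : Fin n, (i : ℕ) < l → f i = g i) : pre f l = pre g l := by
  ext j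
  simp only [mem_pre]
  constructor
  · rintro ⟨i, hi, rfl⟩; exact ⟨i, hi, (h i hi).symm⟩
  · rintro ⟨i, hi, rfl⟩; exact ⟨i, hi, (h i hi)⟩

structure Setup {n m : ℕ} (N : Fin m → Fin n → ℝ) (k : Fin m → ℝ)
    (K : Finset (Fin m) → Prop) (J : Finset (Fin m) → Finset (Fin m))
    (w : Finset (Fin m) → Fin n → ℝ) : Prop where
  wmem : ∀ I, K I → ∀ j, dot (w I) (N j) ≤ k j
  tight : ∀ I, K I → ∀ j, dot (w I) (N j) = k j ↔ j ∈ J I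
  sub : ∀ I, K I → I ⊆ J I
  card : ∀ I, K I → (J I).card = n
  inj : ∀ I, K I → ∀ x : Fin n → ℝ, (∀ j ∈ J I, dot x (N j) = 0) → x = 0
  surj : ∀ I, K I → ∀ c : Fin m → ℝ, ∃ d : Fin n → ℝ, ∀ j ∈ J I, dot d (N j) = c j
  hK : ∀ (I : Finset (Fin m)) (x : Fin n → ℝ), (∀ j, dot x (N j) ≤ k j) →
    (∀ j ∈ I, dot x (N j) = k j) → K I
  hK0 : K ∅
  rec0 : ∀ d : Fin n → ℝ, (∀ j, dot d (N j) ≤ 0) → d = 0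

def IsFlag {n m : ℕ} (K : Finset (Fin m) → Prop) (J : Finset (Fin m) → Finset (Fin m))
    (f : Fin n → Fin m) : Prop :=
  (∀ l : Fin n, f l ∉ J (pre f l)) ∧ ∀ l ≤ n, K (pre f l)

section
variable {n m : ℕ} {N : Fin m → Fin n → ℝ} {k : Fin m → ℝ}
    {K : Finset (Fin m) → Prop} {J : Finset (Fin m) → Finset (Fin m)}
    {w : Finset (Fin m) → Fin n → ℝ}

lemma IsFlag.inj (H : Setup N k K J w) {f : Fin n → Fin m} (hf : IsFlag K J f) :
    Function.Injective f := by
  have key : ∀ r s : Fin n, r < s → f r ≠ f s := by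
    intro r s hrs h
    apply hf.1 s
    apply H.sub _ (hf.2 s s.2.le)
    exact mem_pre.2 ⟨r, hrs, h⟩
  intro r s h
  rcases lt_trichotomy r s with h1 | h1 | h1
  · exact (key r s h1 h).elim
  · exact h1
  · exact (key s r h1 h.symm).elim

lemma IsFlag.last (H : Setup N k K J w) {f : Fin n → Fin m} (hf : IsFlag K J f) :
    J (pre f n) = pre f n := by
  symm
  apply Finset.eq_of_subset_of_card_le (H.sub _ (hf.2 n le_rfl))
  rw [H.card _ (hf.2 n le_rfl), pre, Finset.card_image_of_injective _ (hf.inj H)]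
  simp

lemma IsFlag.gap_zero (H : Setup N k K J w) {f : Fin n → Fin m} (hf : IsFlag K J f)
    (r : Fin n) (l : ℕ) (hrl : (r : ℕ) < l) (hl : l ≤ n) :
    k (f r) - dot (w (pre f l)) (N (f r)) = 0 := by
  have := (H.tight _ (hf.2 l hl) (f r)).2 (H.sub _ (hf.2 l hl) (mem_pre.2 ⟨r, hrl, rfl⟩))
  linarith

lemma IsFlag.gap_pos (H : Setup N k K J w) {f : Fin n → Fin m} (hf : IsFlag K J f)
    (r : Fin n) : 0 < k (f r) - dot (w (pre f r)) (N (f r)) := by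
  have h1 := H.wmem _ (hf.2 r r.2.le) (f r)
  have h2 := (H.tight _ (hf.2 r r.2.le) (f r)).not.2 (hf.1 r)
  have := lt_of_le_of_ne h1 h2
  linarith

lemma gap_comb (b : ℕ → ℝ) (p : ℕ → Fin n → ℝ) (q : ℕ) (hb : ∑ l ∈ Finset.range q, b l = 1)
    (j : Fin m) : k j - dot (∑ l ∈ Finset.range q, b l • p l) (N j)
      = ∑ l ∈ Finset.range q, b l * (k j - dot (p l) (N j)) := by
  rw [dot_sum_l]
  simp only [dot_smul_l, mul_sub, Finset.sum_sub_distrib, ← Finset.sum_mul, hb, one_mul]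

lemma sum_trunc (F : ℕ → ℝ) (n i : ℕ) (hi : i < n) (h : ∀ l, i < l → l ≤ n → F l = 0) :
    ∑ l ∈ Finset.range (n + 1), F l = ∑ l ∈ Finset.range i, F l + F i := by
  rw [← Finset.sum_range_succ]
  symm
  apply Finset.sum_subset
  · intro x; simp; omega
  · intro x h1 h2
    simp at h1 h2
    exact h x (by omega) (by omega)

lemma sum_ge (F : ℕ → ℝ) (n i : ℕ) (hi : i < n) (h : ∀ l, i < l → l ≤ n → 0 ≤ F l) :
    ∑ l ∈ Finset.range i, F l + F i ≤ ∑ l ∈ Finset.range (n + 1), F l := by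
  rw [← Finset.sum_range_succ]
  apply Finset.sum_le_sum_of_subset_of_nonneg
  · intro x; simp; omega
  · intro x h1 h2
    simp at h1 h2
    exact h x (by omega) (by omega)

lemma sum_ge' (F : ℕ → ℝ) (n i r : ℕ) (hi : i < n) (hr : i < r) (hr' : r ≤ n)
    (h : ∀ l, i < l → l ≤ n → 0 ≤ F l) :
    ∑ l ∈ Finset.range i, F l + F i + F r ≤ ∑ l ∈ Finset.range (n + 1), F l := by
  have : ∑ l ∈ Finset.range i, F l + F i + F r
      = ∑ l ∈ insert r (Finset.range (i + 1)), F l := by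
    rw [Finset.sum_insert (by simp; omega), Finset.sum_range_succ]; ring
  rw [this]
  apply Finset.sum_le_sum_of_subset_of_nonneg
  · intro x; simp; omega
  · intro x h1 h2
    simp at h1 h2
    exact h x (by omega) (by omega)

lemma step_le (H : Setup N k K J w) {f g : Fin n → Fin m} (hf : IsFlag K J f)
    (hg : IsFlag K J g) (b c : ℕ → ℝ) (hc : ∀ l ≤ n, 0 < c l)
    (hb1 : ∑ l ∈ Finset.range (n+1), b l = 1) (hc1 : ∑ l ∈ Finset.range (n+1), c l = 1)
    (heq : ∑ l ∈ Finset.range (n+1), b l • w (pre f l)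
      = ∑ l ∈ Finset.range (n+1), c l • w (pre g l))
    (i : Fin n) (hfg : ∀ r : Fin n, r < i → f r = g r) (hbc : ∀ l < (i : ℕ), b l = c l) :
    c i ≤ b i ∧ (c i = b i → ∀ r, (i : ℕ) < r → r ≤ n → f i ∈ J (pre g r)) := by
  have h1 := gap_comb (k := k) (N := N) b (fun l => w (pre f l)) (n+1) hb1 (f i)
  have h2 := gap_comb (k := k) (N := N) c (fun l => w (pre g l)) (n+1) hc1 (f i)
  rw [heq, h2, sum_trunc (fun l => b l * (k (f i) - dot (w (pre f l)) (N (f i)))) n i i.2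
    (by intro l hl hl'; rw [hf.gap_zero H i l hl hl', mul_zero])] at h1
  have hpre : ∀ l ≤ (i : ℕ), pre f l = pre g l := by
    intro l hl
    apply pre_congr
    intro r hr
    exact hfg r (by rw [Fin.lt_def]; omega)
  have hs : ∑ l ∈ Finset.range i, b l * (k (f i) - dot (w (pre f l)) (N (f i)))
      = ∑ l ∈ Finset.range i, c l * (k (f i) - dot (w (pre g l)) (N (f i))) := by
    apply Finset.sum_congr rfl
    intro l hl
    simp at hl
    rw [hbc l hl, hpre l hl.le]
  have hp := hf.gap_pos H i
  have hnn : ∀ l, (i : ℕ) < l → l ≤ n →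
      0 ≤ (fun l => c l * (k (f i) - dot (w (pre g l)) (N (f i)))) l := by
    intro l _ hl
    have := H.wmem _ (hg.2 l hl) (f i)
    exact mul_nonneg (hc l hl).le (by linarith)
  have h3 := sum_ge (fun l => c l * (k (f i) - dot (w (pre g l)) (N (f i)))) n i i.2 hnn
  rw [h1, hs, ← hpre i le_rfl] at h3
  constructor
  · have h4 : c i * (k (f i) - dot (w (pre f i)) (N (f i)))
        ≤ b i * (k (f i) - dot (w (pre f i)) (N (f i))) := by linarith
    exact le_of_mul_le_mul_right h4 hp
  · intro hcb r hr hr'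
    have h5 := sum_ge' (fun l => c l * (k (f i) - dot (w (pre g l)) (N (f i)))) n i r i.2 hr hr' hnn
    rw [h1, hs, ← hpre i le_rfl, hcb] at h5
    have h6 : c r * (k (f i) - dot (w (pre g r)) (N (f i))) ≤ 0 := by linarith
    have h7 : k (f i) - dot (w (pre g r)) (N (f i)) ≤ 0 := by
      by_contra h
      push Not at h
      have := mul_pos (hc r hr') h
      linarith
    have h8 := H.wmem _ (hg.2 r hr') (f i)
    exact (H.tight _ (hg.2 r hr') (f i)).1 (by linarith)

lemma flag_disj (H : Setup N k K J w) {f g : Fin n → Fin m} (hf : IsFlag K J f)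
    (hg : IsFlag K J g) (b c : ℕ → ℝ) (hb : ∀ l ≤ n, 0 < b l) (hc : ∀ l ≤ n, 0 < c l)
    (hb1 : ∑ l ∈ Finset.range (n+1), b l = 1) (hc1 : ∑ l ∈ Finset.range (n+1), c l = 1)
    (heq : ∑ l ∈ Finset.range (n+1), b l • w (pre f l)
      = ∑ l ∈ Finset.range (n+1), c l • w (pre g l)) : f = g := by
  have main : ∀ q : ℕ, ∀ i : Fin n, (i : ℕ) = q → (f i = g i ∧ b i = c i) := by
    intro q
    induction q using Nat.strong_induction_on with
    | _ q ih =>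
    intro i hi
    subst hi
    have hfg : ∀ r : Fin n, r < i → f r = g r := fun r hr => (ih r hr r rfl).1
    have hbc : ∀ l < (i : ℕ), b l = c l := fun l hl =>
      (ih l hl ⟨l, by omega⟩ rfl).2
    obtain ⟨h1, h1'⟩ := step_le H hf hg b c hc hb1 hc1 heq i hfg hbc
    obtain ⟨h2, -⟩ := step_le H hg hf c b hb hc1 hb1 heq.symm i
      (fun r hr => (hfg r hr).symm) (fun l hl => (hbc l hl).symm)
    refine ⟨?_, le_antisymm h2 h1⟩
    have h3 := h1' (le_antisymm h1 h2)
    have h4 := h3 n i.2 le_rfl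
    rw [hg.last H, mem_pre] at h4
    obtain ⟨s, -, hs⟩ := h4
    rcases lt_trichotomy s i with h | h | h
    · rw [← hfg s h] at hs
      exact absurd (hf.inj H hs) h.ne
    · rw [← hs, h]
    · exact absurd (hs ▸ h3 s h s.2.le) (hg.1 s)
  ext i
  rw [(main i i rfl).1]

lemma exit_lemma (hrec : ∀ d : Fin n → ℝ, (∀ j, dot d (N j) ≤ 0) → d = 0)
    (v d : Fin n → ℝ) (hv : ∀ j, dot v (N j) ≤ k j) (hd : d ≠ 0) :
    ∃ t : ℝ, 0 ≤ t ∧ (∀ j, dot (v + t • d) (N j) ≤ k j) ∧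
      ∃ j, 0 < dot d (N j) ∧ dot (v + t • d) (N j) = k j := by
  have hne : (Finset.univ.filter fun j => 0 < dot d (N j)).Nonempty := by
    by_contra h
    apply hd
    apply hrec
    intro j
    by_contra hj
    exact h ⟨j, by simpa using hj⟩
  obtain ⟨j, hj, hmin⟩ := Finset.exists_min_image _
    (fun j => (k j - dot v (N j)) / dot d (N j)) hne
  simp only [Finset.mem_filter, Finset.mem_univ, true_and] at hj hmin
  have ht : 0 ≤ (k j - dot v (N j)) / dot d (N j) :=
    div_nonneg (by linarith [hv j]) hj.le
  refine ⟨(k j - dot v (N j)) / dot d (N j), ht, ?_, j, hj, ?_⟩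
  · intro i
    rw [dot_add_l, dot_smul_l]
    by_cases hi : 0 < dot d (N i)
    · have := hmin i hi
      rw [le_div_iff₀ hi] at this
      linarith
    · have := mul_nonpos_of_nonneg_of_nonpos ht (not_lt.1 hi)
      linarith [hv i]
  · rw [dot_add_l, dot_smul_l, div_mul_cancel₀ _ hj.ne']
    ring

lemma face_step (H : Setup N k K J w) (I : Finset (Fin m)) (hI : K I) (hcard : I.card < n)
    (y : Fin n → ℝ) (hy : ∀ j, dot y (N j) ≤ k j) (hyI : ∀ j ∈ I, dot y (N j) = k j) :
    ∃ j, j ∉ J I ∧ ∃ z : Fin n → ℝ, (∀ j, dot z (N j) ≤ k j) ∧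
      (∀ i ∈ I, dot z (N i) = k i) ∧ dot z (N j) = k j ∧
      ∃ t : ℝ, 0 ≤ t ∧ t ≤ 1 ∧ y = (1 - t) • w I + t • z := by
  have gen : ∀ d : Fin n → ℝ, d ≠ 0 → (∀ j ∈ J I, dot d (N j) ≤ 0) →
      (∀ j ∈ I, dot d (N j) = 0) → ∃ t : ℝ, 0 ≤ t ∧ ∃ j, j ∉ J I ∧ 0 < dot d (N j) ∧
      (∀ i, dot (w I + t • d) (N i) ≤ k i) ∧ (∀ i ∈ I, dot (w I + t • d) (N i) = k i) ∧
      dot (w I + t • d) (N j) = k j := by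
    intro d hd h1 h2
    obtain ⟨t, ht, hm, j, hj, hjt⟩ := exit_lemma H.rec0 (w I) d (H.wmem I hI) hd
    refine ⟨t, ht, j, fun h => absurd (h1 j h) (not_le.2 hj), hj, hm, ?_, hjt⟩
    intro i hi
    rw [dot_add_l, dot_smul_l, h2 i hi, (H.tight I hI i).2 (H.sub I hI hi)]
    ring
  by_cases hyw : y = w I
  · obtain ⟨d, hd⟩ := H.surj I hI (fun j => if j ∈ I then 0 else -1)
    have hd0 : d ≠ 0 := by
      rintro rfl
      obtain ⟨j, hj, hj'⟩ := Finset.exists_mem_notMem_of_card_lt_card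
        (s := I) (t := J I) (by rw [H.card I hI]; exact hcard)
      have := hd j hj
      simp [hj', dot] at this
    obtain ⟨t, ht, j, hj, -, h1, h2, h3⟩ := gen d hd0
      (by intro j hj; rw [hd j hj]; split_ifs <;> norm_num)
      (by intro j hj; rw [hd j (H.sub I hI hj)]; simp [hj])
    exact ⟨j, hj, _, h1, h2, h3, 0, le_rfl, zero_le_one, by simp [hyw]⟩
  · obtain ⟨t, ht, j, hj, hjp, h1, h2, h3⟩ := gen (y - w I) (sub_ne_zero.2 hyw)
      (by intro j hj; rw [dot_sub_l, (H.tight I hI j).2 hj]; linarith [hy j])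
      (by intro j hj; rw [dot_sub_l, (H.tight I hI j).2 (H.sub I hI hj), hyI j hj]; ring)
    have ht1 : 1 ≤ t := by
      rw [dot_add_l, dot_smul_l] at h3
      have h4 : dot (w I) (N j) + dot (y - w I) (N j) ≤ k j := by
        rw [dot_sub_l]; linarith [hy j]
      by_contra h
      push Not at h
      nlinarith
    refine ⟨j, hj, _, h1, h2, h3, t⁻¹, by positivity, inv_le_one_of_one_le₀ ht1, ?_⟩
    rw [smul_add, smul_smul, inv_mul_cancel₀ (by positivity)]
    module

lemma cover_aux (H : Setup N k K J w) (f0 : Fin n → Fin m)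
    (x : Fin n → ℝ) (hx : ∀ j, dot x (N j) ≤ k j) (i : ℕ) (hi : i ≤ n) :
    ∃ f : Fin n → Fin m, (∀ l : Fin n, (l : ℕ) < i → f l ∉ J (pre f l)) ∧
      (∀ l ≤ i, K (pre f l)) ∧ (pre f i).card ≤ i ∧
      ∃ (b : ℕ → ℝ) (y : Fin n → ℝ) (c : ℝ), (∀ l, 0 ≤ b l) ∧ 0 ≤ c ∧
        (∀ j, dot y (N j) ≤ k j) ∧ (∀ j ∈ pre f i, dot y (N j) = k j) ∧
        ∑ l ∈ Finset.range i, b l + c = 1 ∧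
        x = ∑ l ∈ Finset.range i, b l • w (pre f l) + c • y := by
  induction i with
  | zero =>
    have hp : pre f0 0 = ∅ := by simp [pre]
    refine ⟨f0, by simp, ?_, by simp [hp], fun _ => 0, x, 1, by simp, by simp, hx, by simp [hp],
      by simp, by simp⟩
    intro l hl
    rw [Nat.le_zero.1 hl, hp]; exact H.hK0
  | succ i ih =>
    obtain ⟨f, hf1, hf2, hcard, b, y, c, hb, hc, hy, hyI, hsum, hxe⟩ := ih (by omega)
    obtain ⟨j, hj, z, hz, hzI, hzj, t, ht0, ht1, hyt⟩ :=
      face_step H (pre f i) (hf2 i le_rfl) (by omega) y hy hyI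
    have hin : i < n := by omega
    set g := Function.update f ⟨i, hin⟩ j with hg
    have hgl : ∀ l : Fin n, (l : ℕ) < i → g l = f l := by
      intro l hl
      rw [hg, Function.update_of_ne]
      rintro rfl
      simp at hl
    have hgi : g ⟨i, hin⟩ = j := by simp [hg]
    have hpre : ∀ l ≤ i, pre g l = pre f l := fun l hl =>
      pre_congr fun r hr => hgl r (by omega)
    have hpres : pre g (i+1) = insert j (pre f i) := by
      ext a
      rw [Finset.mem_insert, ← hpre i le_rfl, mem_pre, mem_pre]
      constructor
      · rintro ⟨r, hr, rfl⟩
        by_cases h : (r : ℕ) < i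
        · exact Or.inr ⟨r, h, rfl⟩
        · left
          have hr' : r = ⟨i, hin⟩ := Fin.ext (by change (r : ℕ) = i; omega)
          rw [hr', hgi]
      · rintro (rfl | ⟨r, hr, rfl⟩)
        · exact ⟨⟨i, hin⟩, by simp, hgi⟩
        · exact ⟨r, by omega, rfl⟩
    have hztight : ∀ j ∈ pre g (i+1), dot z (N j) = k j := by
      intro a ha
      rw [hpres, Finset.mem_insert] at ha
      rcases ha with rfl | ha
      · exact hzj
      · exact hzI a ha
    refine ⟨g, ?_, ?_, ?_, fun l => if l = i then c * (1 - t) else b l, z, c * t, ?_,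
      mul_nonneg hc ht0, hz, hztight, ?_, ?_⟩
    · intro l hl
      rw [hpre l (by omega)]
      by_cases h : (l : ℕ) < i
      · rw [hgl l h]; exact hf1 l h
      · have : l = ⟨i, hin⟩ := by ext; simp; omega
        rw [this, hgi]; exact hj
    · intro l hl
      by_cases h : l ≤ i
      · rw [hpre l h]; exact hf2 l h
      · have : l = i + 1 := by omega
        rw [this]
        exact H.hK _ z hz hztight
    · rw [hpres]
      exact (Finset.card_insert_le _ _).trans (by omega)
    · intro l
      simp only
      split_ifs
      · exact mul_nonneg hc (by linarith)
      · exact hb l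
    · rw [Finset.sum_range_succ, Finset.sum_congr rfl (g := b)]
      · simp; linarith
      · intro l hl
        simp at hl
        simp [hl.ne]
    · rw [Finset.sum_range_succ, Finset.sum_congr rfl (g := fun l => b l • w (pre f l)), hxe]
      · rw [hpre i le_rfl]
        simp only [if_true]
        conv_lhs => rw [hyt]
        module
      · intro l hl
        simp at hl
        simp only [hl.ne, if_false]
        rw [hpre l hl.le]

lemma cover (H : Setup N k K J w) (f0 : Fin n → Fin m)
    (x : Fin n → ℝ) (hx : ∀ j, dot x (N j) ≤ k j) :
    ∃ f : Fin n → Fin m, IsFlag K J f ∧ ∃ b : ℕ → ℝ, (∀ l, 0 ≤ b l) ∧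
      ∑ l ∈ Finset.range (n+1), b l = 1 ∧
      x = ∑ l ∈ Finset.range (n+1), b l • w (pre f l) := by
  obtain ⟨f, hf1, hf2, -, b, y, c, hb, hc, hy, hyI, hsum, hxe⟩ := cover_aux H f0 x hx n le_rfl
  have hf : IsFlag K J f := ⟨fun l => hf1 l l.2, hf2⟩
  have hyw : y = w (pre f n) := by
    rw [← sub_eq_zero]
    apply H.inj _ (hf2 n le_rfl)
    intro j hj
    rw [dot_sub_l, (H.tight _ (hf2 n le_rfl) j).2 hj]
    rw [hf.last H] at hj
    rw [hyI j hj, sub_self]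
  refine ⟨f, hf, fun l => if l = n then c else b l, ?_, ?_, ?_⟩
  · intro l; simp only; split_ifs
    · exact hc
    · exact hb l
  · rw [Finset.sum_range_succ, Finset.sum_congr rfl (g := b)]
    · simpa using hsum
    · intro l hl
      simp at hl
      simp [hl.ne]
  · rw [Finset.sum_range_succ, Finset.sum_congr rfl (g := fun l => b l • w (pre f l)), hxe]
    · simp [hyw]
    · intro l hl
      simp at hl
      simp [hl.ne]

end

lemma hyper_null {n : ℕ} (φ : (Fin n → ℝ) →ₗ[ℝ] ℝ) (c : ℝ) (h : φ ≠ 0 ∨ c ≠ 0) :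
    volume {a : Fin n → ℝ | φ a = c} = 0 := by
  rcases Set.eq_empty_or_nonempty {a : Fin n → ℝ | φ a = c} with he | ⟨a0, ha0⟩
  · rw [he]; simp
  have hφ : φ ≠ 0 := by
    rintro rfl
    simp at h ha0
    exact h ha0.symm
  have ha0 : φ a0 = c := ha0
  have : {a : Fin n → ℝ | φ a = c} = (fun x => -a0 + x) ⁻¹' (LinearMap.ker φ : Set (Fin n → ℝ)) := by
    ext a
    simp only [Set.mem_ofPred_eq, Set.mem_preimage, SetLike.mem_coe, LinearMap.mem_ker, map_add,
      map_neg, ha0]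
    constructor <;> intro h <;> linarith
  rw [this, measure_preimage_add]
  apply Measure.addHaar_submodule
  rwa [Ne, LinearMap.ker_eq_top]

def TC (n : ℕ) : Set (Fin n → ℝ) := {a | (∀ i, 0 ≤ a i) ∧ ∑ i, a i ≤ 1}
def TO (n : ℕ) : Set (Fin n → ℝ) := {a | (∀ i, 0 < a i) ∧ ∑ i, a i < 1}

lemma TO_sub (n : ℕ) : TO n ⊆ TC n := fun _ h => ⟨fun i => (h.1 i).le, h.2.le⟩

lemma TC_closed (n : ℕ) : IsClosed (TC n) := by
  have : TC n = (⋂ i, {a | 0 ≤ a i}) ∩ {a | ∑ i, a i ≤ 1} := by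
    ext; simp [TC]
  rw [this]
  refine (isClosed_iInter fun i => isClosed_le continuous_const (continuous_apply i)).inter
    (isClosed_le (by fun_prop) continuous_const)

lemma TC_compact (n : ℕ) : IsCompact (TC n) := by
  apply Metric.isCompact_of_isClosed_isBounded (TC_closed n)
  apply (Metric.isBounded_Icc (0 : Fin n → ℝ) 1).subset
  intro a ha
  refine ⟨fun i => ha.1 i, fun i => ?_⟩
  exact (Finset.single_le_sum (fun j _ => ha.1 j) (Finset.mem_univ i)).trans ha.2

lemma TO_open (n : ℕ) : IsOpen (TO n) := by
  have : TO n = (⋂ i, {a | 0 < a i}) ∩ {a | ∑ i, a i < 1} := by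
    ext; simp [TO]
  rw [this]
  refine (isOpen_iInter_of_finite fun i => isOpen_lt continuous_const (continuous_apply i)).inter
    (isOpen_lt (by fun_prop) continuous_const)

lemma T_diff (n : ℕ) : volume (TC n \ TO n) = 0 := by
  have hsub : TC n \ TO n ⊆ (⋃ i : Fin n, {a | (LinearMap.proj i : (Fin n → ℝ) →ₗ[ℝ] ℝ) a = 0}) ∪
      {a | (∑ i, (LinearMap.proj i : (Fin n → ℝ) →ₗ[ℝ] ℝ)) a = 1} := by
    rintro a ⟨h1, h2⟩
    by_contra h
    apply h2
    simp at h
    exact ⟨fun i => lt_of_le_of_ne (h1.1 i) (Ne.symm (h.1 i)), lt_of_le_of_ne h1.2 h.2⟩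
  apply measure_mono_null hsub
  apply measure_union_null
  · apply measure_iUnion_null
    intro i
    apply hyper_null
    left
    intro h
    have := congrArg (fun φ => φ (fun _ => 1)) h
    simp at this
  · exact hyper_null _ _ (Or.inr one_ne_zero)

lemma T_vol (n : ℕ) : volume (TO n) = volume (TC n) := by
  apply le_antisymm (measure_mono (TO_sub n))
  calc volume (TC n) ≤ volume (TO n ∪ (TC n \ TO n)) := by
        apply measure_mono; intro a ha; by_cases h : a ∈ TO n
        · exact Or.inl h
        · exact Or.inr ⟨ha, h⟩
    _ ≤ volume (TO n) + volume (TC n \ TO n) := measure_union_le _ _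
    _ = volume (TO n) := by rw [T_diff, add_zero]

section
variable {n m : ℕ} {N : Fin m → Fin n → ℝ} {k : Fin m → ℝ}
    {K : Finset (Fin m) → Prop} {J : Finset (Fin m) → Finset (Fin m)}
    {w : Finset (Fin m) → Fin n → ℝ}

/-- edge matrix -/
def DM (w : Finset (Fin m) → Fin n → ℝ) (f : Fin n → Fin m) : Matrix (Fin n) (Fin n) ℝ :=
  Matrix.of fun r i => (w (pre f i) - w (pre f n)) r

def Phi (w : Finset (Fin m) → Fin n → ℝ) (f : Fin n → Fin m) (a : Fin n → ℝ) : Fin n → ℝ :=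
  w (pre f n) + Matrix.toLin' (DM w f) a

lemma Phi_vol (w : Finset (Fin m) → Fin n → ℝ) (f : Fin n → Fin m) (s : Set (Fin n → ℝ)) :
    volume (Phi w f '' s) = ENNReal.ofReal |(DM w f).det| * volume s := by
  have : Phi w f '' s = (fun x => -w (pre f n) + x) ⁻¹' (Matrix.toLin' (DM w f) '' s) := by
    rw [← Set.image_add_left, Set.image_image]
    rfl
  rw [this, measure_preimage_add, Measure.addHaar_image_linearMap, LinearMap.det_toLin']

/-- barycentric coordinates -/
def bary (a : Fin n → ℝ) (l : ℕ) : ℝ := if h : l < n then a ⟨l, h⟩ else 1 - ∑ i, a i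

lemma bary_sum (a : Fin n → ℝ) : ∑ l ∈ Finset.range (n+1), bary a l = 1 := by
  rw [Finset.sum_range_succ, ← Fin.sum_univ_eq_sum_range]
  simp [bary]

lemma Phi_bary (w : Finset (Fin m) → Fin n → ℝ) (f : Fin n → Fin m) (a : Fin n → ℝ) :
    Phi w f a = ∑ l ∈ Finset.range (n+1), bary a l • w (pre f l) := by
  rw [Finset.sum_range_succ, ← Fin.sum_univ_eq_sum_range (fun l => bary a l • w (pre f l))]
  ext r
  simp [Phi, bary, DM, Matrix.mulVec, dotProduct, Finset.sum_sub_distrib, mul_comm, mul_sub]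
  rw [← Finset.sum_mul]
  ring

lemma bary_of (b : ℕ → ℝ) (hb : ∑ l ∈ Finset.range (n+1), b l = 1) (l : ℕ) (hl : l ≤ n) :
    bary (fun i : Fin n => b i) l = b l := by
  unfold bary
  split_ifs with h
  · rfl
  · have : l = n := by omega
    subst this
    rw [Finset.sum_range_succ] at hb
    rw [Fin.sum_univ_eq_sum_range]
    linarith

lemma det_prod (H : Setup N k K J w) {f : Fin n → Fin m} (hf : IsFlag K J f) :
    |(Matrix.of fun i i' => N (f i) i').det| * |(DM w f).det|
      = ∏ i : Fin n, (k (f i) - dot (w (pre f i)) (N (f i))) := by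
  rw [← abs_mul, ← Matrix.det_mul]
  have hent : ∀ j i : Fin n, ((Matrix.of fun i i' => N (f i) i') * DM w f) j i
      = dot (w (pre f i)) (N (f j)) - k (f j) := by
    intro j i
    have h := hf.gap_zero H j n j.2 le_rfl
    have : ((Matrix.of fun i i' => N (f i) i') * DM w f) j i
        = dot (w (pre f i) - w (pre f n)) (N (f j)) := by
      simp [Matrix.mul_apply, DM, dot, mul_comm]
    rw [this, dot_sub_l]
    linarith
  rw [Matrix.det_of_isLowerTriangular]
  · rw [Finset.abs_prod]
    apply Finset.prod_congr rfl
    intro i _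
    rw [hent, abs_sub_comm, abs_of_pos (hf.gap_pos H i)]
  · intro j i hij
    have hij : j < i := hij
    rw [hent]
    have := hf.gap_zero H j i hij i.2.le
    linarith

lemma vol_formula (H : Setup N k K J w) (f0 : Fin n → Fin m) (S : Finset (Fin n → Fin m))
    (hS : ∀ f, f ∈ S ↔ IsFlag K J f) :
    (volume (PolyDelta N k)).toReal = ∑ f ∈ S, ((volume (TC n)).toReal /
      |(Matrix.of fun i i' => N (f i) i').det|) *
        ∏ i : Fin n, (k (f i) - dot (w (pre f i)) (N (f i))) := by
  have hdet : ∀ f ∈ S, (Matrix.of fun i i' => N (f i) i').det ≠ 0 ∧ (DM w f).det ≠ 0 := by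
    intro f hf
    have h1 := det_prod H ((hS f).1 hf)
    have h2 : 0 < ∏ i : Fin n, (k (f i) - dot (w (pre f i)) (N (f i))) :=
      Finset.prod_pos fun i _ => ((hS f).1 hf).gap_pos H i
    rw [← h1] at h2
    constructor <;> intro h <;> simp [h] at h2
  have hv : volume (PolyDelta N k) = ∑ f ∈ S, ENNReal.ofReal |(DM w f).det| * volume (TC n) := by
    apply le_antisymm
    · calc volume (PolyDelta N k) ≤ volume (⋃ f ∈ S, Phi w f '' TC n) := by
            apply measure_mono
            intro x hx
            obtain ⟨f, hf, b, hb, hb1, hxe⟩ := cover H f0 x hx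
            simp only [Set.mem_iUnion]
            refine ⟨f, (hS f).2 hf, fun i => b i, ⟨fun i => hb i, ?_⟩, ?_⟩
            · rw [Fin.sum_univ_eq_sum_range]
              rw [Finset.sum_range_succ] at hb1
              linarith [hb n]
            · rw [Phi_bary, hxe]
              apply Finset.sum_congr rfl
              intro l hl
              simp at hl
              rw [bary_of b hb1 l (by omega)]
        _ ≤ ∑ f ∈ S, volume (Phi w f '' TC n) := measure_biUnion_finset_le _ _
        _ = _ := Finset.sum_congr rfl fun f _ => Phi_vol _ _ _
    · calc _ = ∑ f ∈ S, volume (Phi w f '' TO n) :=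
            Finset.sum_congr rfl fun f _ => by rw [Phi_vol, T_vol]
        _ = volume (⋃ f ∈ S, Phi w f '' TO n) := by
            symm
            apply measure_biUnion_finset
            · intro f hf g hg hfg
              rw [Function.onFun, Set.disjoint_left]
              rintro x ⟨a, ha, rfl⟩ ⟨a', ha', he⟩
              apply hfg
              have pos : ∀ a ∈ TO n, ∀ l ≤ n, 0 < bary a l := by
                intro a ha l hl
                unfold bary
                split_ifs with h
                · exact ha.1 _
                · linarith [ha.2]
              refine flag_disj H ((hS f).1 hf) ((hS g).1 hg) (bary a) (bary a') (pos a ha)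
                (pos a' ha') (bary_sum a) (bary_sum a') ?_
              rw [← Phi_bary, ← Phi_bary, he]
            · intro f hf
              have hinj : Function.Injective (Phi w f) := by
                intro a a' h
                unfold Phi at h
                have h' := add_left_cancel h
                rw [Matrix.toLin'_apply, Matrix.toLin'_apply] at h'
                exact Matrix.mulVec_injective_of_isUnit
                  ((Matrix.isUnit_iff_isUnit_det _).2 (isUnit_iff_ne_zero.2 (hdet f hf).2)) h'
              apply (TO_open n).measurableSet.image_of_continuousOn_injOn _ hinj.injOn
              apply Continuous.continuousOn
              unfold Phi
              exact continuous_const.add (LinearMap.continuous_of_finiteDimensional _)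
        _ ≤ volume (PolyDelta N k) := by
            apply measure_mono
            intro x hx
            simp only [Set.mem_iUnion] at hx
            obtain ⟨f, hf, a, ha, rfl⟩ := hx
            have hf := (hS f).1 hf
            intro j
            rw [← sub_nonneg, Phi_bary, gap_comb _ _ _ (bary_sum a)]
            apply Finset.sum_nonneg
            intro l hl
            simp at hl
            apply mul_nonneg
            · unfold bary
              split_ifs with h
              · exact (ha.1 _).le
              · linarith [ha.2]
            · linarith [H.wmem _ (hf.2 l (by omega)) j]
  rw [hv, ENNReal.toReal_sum]
  · apply Finset.sum_congr rfl
    intro f hf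
    rw [← det_prod H ((hS f).1 hf), ENNReal.toReal_mul, ENNReal.toReal_ofReal (abs_nonneg _)]
    have := abs_ne_zero.2 (hdet f hf).1
    field_simp
  · intro f _
    exact ENNReal.mul_ne_top ENNReal.ofReal_ne_top (TC_compact n).measure_lt_top.ne

end

def FF {n m : ℕ} (N : Fin m → Fin n → ℝ) (k : Fin m → ℝ) (I : Finset (Fin m)) :
    Set (Fin n → ℝ) := {x | (∀ j, dot x (N j) ≤ k j) ∧ ∀ j ∈ I, dot x (N j) = k j}

lemma FF_eq {n m : ℕ} (N : Fin m → Fin n → ℝ) (k : Fin m → ℝ) (I : Finset (Fin m))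
    (hI : I.Nonempty) : (⋂ j ∈ I, PolyFacet N k j) = FF N k I := by
  ext x
  simp only [Set.mem_iInter]
  constructor
  · intro h
    obtain ⟨j, hj⟩ := hI
    exact ⟨(h j hj).1, fun i hi => (h i hi).2⟩
  · intro h j hj
    exact ⟨h.1, h.2 j hj⟩

lemma dot_cont {n : ℕ} (y : Fin n → ℝ) : Continuous fun x => dot x y := by
  unfold dot; fun_prop

lemma FF_extreme {n m : ℕ} (N : Fin m → Fin n → ℝ) (k : Fin m → ℝ) (I : Finset (Fin m)) :
    IsExtreme ℝ (PolyDelta N k) (FF N k I) := by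
  refine ⟨fun x hx => hx.1, ?_⟩
  rintro x hx y hy z hz ⟨a, b, ha, hb, hab, rfl⟩
  refine ⟨hx, fun j hj => ?_⟩
  have h1 := hz.2 j hj
  rw [dot_add_l, dot_smul_l, dot_smul_l] at h1
  have h2 := hx j
  have h3 := hy j
  by_contra h
  have h4 : dot x (N j) < k j := lt_of_le_of_ne h2 h
  have hb' : b = 1 - a := by linarith
  subst hb'
  nlinarith

lemma FF_vertex {n m : ℕ} (N : Fin m → Fin n → ℝ) (k : Fin m → ℝ)
    (hcpt : IsCompact (PolyDelta N k)) (I : Finset (Fin m)) (hI : (FF N k I).Nonempty) :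
    ∃ v ∈ Set.extremePoints ℝ (PolyDelta N k), v ∈ FF N k I := by
  have hcl : IsClosed (FF N k I) := by
    have : FF N k I = (⋂ j, {x | dot x (N j) ≤ k j}) ∩ ⋂ j ∈ I, {x | dot x (N j) = k j} := by
      ext; simp [FF]
    rw [this]
    refine (isClosed_iInter fun j => isClosed_le (dot_cont _) continuous_const).inter
      (isClosed_biInter fun j _ => isClosed_eq (dot_cont _) continuous_const)
  have hc : IsCompact (FF N k I) := hcpt.of_isClosed_subset hcl fun x hx => hx.1
  obtain ⟨v, hv⟩ := hc.extremePoints_nonempty hI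
  exact ⟨v, (FF_extreme N k I).extremePoints_subset_extremePoints hv, hv.1⟩

lemma rec_zero {n m : ℕ} (N : Fin m → Fin n → ℝ) (k : Fin m → ℝ)
    (hcpt : IsCompact (PolyDelta N k)) (v : Fin n → ℝ) (hv : v ∈ PolyDelta N k)
    (d : Fin n → ℝ) (hd : ∀ j, dot d (N j) ≤ 0) : d = 0 := by
  obtain ⟨C, hC⟩ := hcpt.isBounded.exists_norm_le
  by_contra h
  have hdp : 0 < ‖d‖ := norm_pos_iff.2 h
  have hC0 : 0 ≤ C := (norm_nonneg _).trans (hC v hv)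
  set t := (2 * C + 1) / ‖d‖ with ht
  have ht0 : 0 ≤ t := by positivity
  have h1 : v + t • d ∈ PolyDelta N k := by
    intro j
    rw [dot_add_l, dot_smul_l]
    have := mul_nonpos_of_nonneg_of_nonpos ht0 (hd j)
    linarith [hv j]
  have h2 : ‖t • d‖ = 2 * C + 1 := by
    rw [norm_smul, Real.norm_of_nonneg ht0, ht, div_mul_cancel₀ _ hdp.ne']
  have h3 : ‖t • d‖ ≤ ‖v + t • d‖ + ‖v‖ := by
    have := norm_sub_le (v + t • d) v
    simpa using this
  linarith [hC _ h1, hC v hv]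

theorem stmt7 {n m : ℕ} (N : Fin m → Fin n → ℝ) (k0 : Fin m → ℝ)
    (hcpt : IsCompact (PolyDelta N k0)) (hint : (interior (PolyDelta N k0)).Nonempty)
    (hDelzant : IsDelzant N k0) :
    ∃ P : MvPolynomial (Fin m) ℝ, P.IsHomogeneous n ∧
      ∀ k ∈ chamber N k0, (volume (PolyDelta N k)).toReal = MvPolynomial.eval k P := by
  classical
  obtain ⟨p, hp⟩ := hint
  have hp : p ∈ PolyDelta N k0 := interior_subset hp
  have hne : ∀ I, (FF N k0 I).Nonempty → ∃ (v : Fin n → ℝ) (J : Finset (Fin m)) (e : Fin n → Fin m),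
      v ∈ FF N k0 I ∧ J.card = n ∧ (∀ j, j ∈ J ↔ dot v (N j) = k0 j) ∧
      (∀ i, e i ∈ J) ∧ Function.Injective e ∧ |(Matrix.of fun i i' => N (e i) i').det| = 1 := by
    intro I hI
    obtain ⟨v, hv, hvI⟩ := FF_vertex N k0 hcpt I hI
    obtain ⟨J, h1, h2, e, h3, h4, h5⟩ := hDelzant.2 v hv
    exact ⟨v, J, e, hvI, h1, h2, h3, h4, h5⟩
  have hK0 : (FF N k0 ∅).Nonempty := ⟨p, hp, by simp⟩
  obtain ⟨v0, J0, e0, -⟩ := hne ∅ hK0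
  have hex : ∀ I, ∃ (v : Fin n → ℝ) (J : Finset (Fin m)) (e : Fin n → Fin m),
      (FF N k0 I).Nonempty →
      v ∈ FF N k0 I ∧ J.card = n ∧ (∀ j, j ∈ J ↔ dot v (N j) = k0 j) ∧
      (∀ i, e i ∈ J) ∧ Function.Injective e ∧ |(Matrix.of fun i i' => N (e i) i').det| = 1 := by
    intro I
    by_cases hI : (FF N k0 I).Nonempty
    · obtain ⟨v, J, e, h⟩ := hne I hI
      exact ⟨v, J, e, fun _ => h⟩
    · exact ⟨v0, J0, e0, fun h => absurd h hI⟩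
  choose v J e hvJe using hex
  let A : Finset (Fin m) → Matrix (Fin n) (Fin n) ℝ := fun I => Matrix.of fun i i' => N (e I i) i'
  let w : (Fin m → ℝ) → Finset (Fin m) → Fin n → ℝ := fun k I =>
    (A I)⁻¹.mulVec fun i => k (e I i)
  let K : Finset (Fin m) → Prop := fun I => (FF N k0 I).Nonempty
  have hAdet : ∀ I, K I → IsUnit (A I).det := by
    intro I hI
    obtain ⟨-, -, -, -, -, h⟩ := hvJe I hI
    rw [isUnit_iff_ne_zero]
    intro h0
    change |(A I).det| = 1 at h
    rw [h0] at h
    simp at h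
  have hJe : ∀ I, K I → ∀ j ∈ J I, ∃ i, e I i = j := by
    intro I hI j hj
    obtain ⟨-, h1, -, h3, h4, -⟩ := hvJe I hI
    have : Finset.univ.image (e I) = J I := by
      apply Finset.eq_of_subset_of_card_le
      · intro a ha
        simp at ha
        obtain ⟨i, rfl⟩ := ha
        exact h3 i
      · rw [h1, Finset.card_image_of_injective _ h4]; simp
    rw [← this] at hj
    simpa using hj
  have hAdot : ∀ I (x : Fin n → ℝ) i, (A I).mulVec x i = dot x (N (e I i)) := by
    intro I x i
    simp [A, Matrix.mulVec, dotProduct, dot, mul_comm]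
  have hinj : ∀ I, K I → ∀ x : Fin n → ℝ, (∀ j ∈ J I, dot x (N j) = 0) → x = 0 := by
    intro I hI x hx
    have h0 : (A I).mulVec x = (A I).mulVec 0 := by
      ext i
      rw [hAdot, hx _ ((hvJe I hI).2.2.2.1 i)]
      simp
    exact Matrix.mulVec_injective_of_isUnit ((Matrix.isUnit_iff_isUnit_det _).2 (hAdet I hI)) h0
  have hw : ∀ I, K I → ∀ c : Fin m → ℝ, ∀ j ∈ J I, dot (w c I) (N j) = c j := by
    intro I hI c j hj
    obtain ⟨i, rfl⟩ := hJe I hI j hj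
    rw [← hAdot]
    simp only [w]
    rw [Matrix.mulVec_mulVec, Matrix.mul_nonsing_inv _ (hAdet I hI), Matrix.one_mulVec]
  have hrec := rec_zero N k0 hcpt p hp
  have hsetup : ∀ k ∈ chamber N k0, Setup N k K J (w k) := by
    intro k hk
    have hk' : ∀ I : Finset (Fin m), I.Nonempty → ((FF N k I).Nonempty ↔ K I) := by
      intro I hI
      have := hk I
      rwa [FF_eq N k I hI, FF_eq N k0 I hI] at this
    have hempty : n = 0 → IsEmpty (Fin m) := by
      rintro rfl
      constructor
      intro j
      obtain ⟨z, -, hz⟩ := hDelzant.1 j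
      simp at hz
    have hKJ : ∀ I, K I → K (J I) := by
      intro I hI
      obtain ⟨h1, -, h2, -⟩ := hvJe I hI
      exact ⟨v I, h1.1, fun j hj => (h2 j).1 hj⟩
    have hwF : ∀ I, K I → w k I ∈ FF N k (J I) := by
      intro I hI
      refine ⟨?_, fun j hj => hw I hI k j hj⟩
      rcases Nat.eq_zero_or_pos n with h0 | hpos
      · intro j
        exact ((hempty h0).false j).elim
      · have hJn : (J I).Nonempty := by
          rw [← Finset.card_pos, (hvJe I hI).2.1]; exact hpos
        obtain ⟨x, hx⟩ := (hk' _ hJn).2 (hKJ I hI)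
        have : x = w k I := by
          rw [← sub_eq_zero]
          apply hinj I hI
          intro j hj
          rw [dot_sub_l, hx.2 j hj, hw I hI k j hj, sub_self]
        rw [← this]; exact hx.1
    refine ⟨fun I hI => (hwF I hI).1, ?_, ?_, fun I hI => (hvJe I hI).2.1, hinj,
      fun I hI c => ⟨w c I, hw I hI c⟩, ?_, hK0, hrec⟩
    · intro I hI j
      refine ⟨fun h => ?_, fun h => hw I hI k j h⟩
      have h1 : (FF N k (insert j (J I))).Nonempty := by
        refine ⟨w k I, (hwF I hI).1, fun i hi => ?_⟩
        rcases Finset.mem_insert.1 hi with rfl | hi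
        · exact h
        · exact hw I hI k i hi
      obtain ⟨x, hx⟩ := (hk' _ (Finset.insert_nonempty _ _)).1 h1
      have hxv : x = v I := by
        rw [← sub_eq_zero]
        apply hinj I hI
        intro i hi
        rw [dot_sub_l, hx.2 i (Finset.mem_insert_of_mem hi),
          ((hvJe I hI).2.2.1 i).1 hi, sub_self]
      rw [(hvJe I hI).2.2.1 j, ← hxv]
      exact hx.2 j (Finset.mem_insert_self _ _)
    · intro I hI j hj
      exact ((hvJe I hI).2.2.1 j).2 ((hvJe I hI).1.2 j hj)
    · intro I x hx hxI
      rcases I.eq_empty_or_nonempty with rfl | hI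
      · exact hK0
      · exact (hk' I hI).1 ⟨x, hx, hxI⟩
  let S : Finset (Fin n → Fin m) := Finset.univ.filter fun f => IsFlag K J f
  let L : Finset (Fin m) → Fin m → MvPolynomial (Fin m) ℝ := fun I j =>
    ∑ i, (∑ r, MvPolynomial.C ((A I)⁻¹ i r) * MvPolynomial.X (e I r)) * MvPolynomial.C (N j i)
  have hL : ∀ I j, (L I j).IsHomogeneous 1 := by
    intro I j
    apply MvPolynomial.IsHomogeneous.sum
    intro i _
    have h1 : (∑ r, MvPolynomial.C ((A I)⁻¹ i r) * MvPolynomial.X (e I r) :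
        MvPolynomial (Fin m) ℝ).IsHomogeneous 1 := by
      apply MvPolynomial.IsHomogeneous.sum
      intro r _
      simpa using (MvPolynomial.isHomogeneous_C (Fin m) ((A I)⁻¹ i r)).mul
        (MvPolynomial.isHomogeneous_X ℝ (e I r))
    simpa using h1.mul (MvPolynomial.isHomogeneous_C (Fin m) (N j i))
  have hLe : ∀ k I j, MvPolynomial.eval k (L I j) = dot (w k I) (N j) := by
    intro k I j
    simp [L, w, dot, Matrix.mulVec, dotProduct]
  refine ⟨∑ f ∈ S, MvPolynomial.C ((volume (TC n)).toReal /
      |(Matrix.of fun i i' => N (f i) i').det|) *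
        ∏ i : Fin n, (MvPolynomial.X (f i) - L (pre f i) (f i)), ?_, ?_⟩
  · apply MvPolynomial.IsHomogeneous.sum
    intro f _
    have h1 : (∏ i : Fin n, (MvPolynomial.X (f i) - L (pre f i) (f i))).IsHomogeneous
        (∑ _i : Fin n, 1) := by
      apply MvPolynomial.IsHomogeneous.prod
      intro i _
      exact (MvPolynomial.isHomogeneous_X ℝ (f i)).sub (hL _ _)
    simpa using (MvPolynomial.isHomogeneous_C (Fin m) _).mul h1
  · intro k hk
    rw [vol_formula (hsetup k hk) e0 S (by intro f; simp [S])]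
    simp [MvPolynomial.eval_prod, hLe]
end
end

section
/- Let n_1,…,n_m ∈ ℝ^n, let Δ = Δ(k⁰) be a compact polytope with nonempty interior, and let (Δ, b) be a mass linear pair with ⟨Cm(Δ(k)), b⟩ = ∑_{j=1}^m R_j k_j + C for all k ∈ C_Δ. Suppose k ∈ C_Δ and k + (1,…,1) ∈ C_Δ, and set d = Cm(Δ(k + (1,…,1))) − Cm(Δ(k)) ∈ ℝ^n. Then ⟨d, b⟩ = ∑_{j=1}^m R_j and ∑_{j=1}^m R_j ⟨d, n_j⟩ = ∑_{j=1}^m R_j. -/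
open MeasureTheory

noncomputable section

theorem dot_add_aux {n : ℕ} (x d y : Fin n → ℝ) : dot (x + d) y = dot x y + dot d y := by
  simp [dot, add_mul, Finset.sum_add_distrib]

theorem facet_aux {n m : ℕ} (N : Fin m → Fin n → ℝ) (k0 : Fin m → ℝ) (d x : Fin n → ℝ)
    (j : Fin m) :
    x + d ∈ PolyFacet N (fun j => k0 j + dot d (N j)) j ↔ x ∈ PolyFacet N k0 j := by
  simp [PolyFacet, PolyDelta, dot_add_aux]

theorem chamber_aux {n m : ℕ} (N : Fin m → Fin n → ℝ) (k0 : Fin m → ℝ) (d : Fin n → ℝ) :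
    (fun j => k0 j + dot d (N j)) ∈ chamber N k0 := by
  intro J
  constructor
  · rintro ⟨x, hx⟩
    refine ⟨x - d, ?_⟩
    simp only [Set.mem_iInter] at hx ⊢
    intro j hj
    rw [← facet_aux N k0 d, sub_add_cancel]
    exact hx j hj
  · rintro ⟨x, hx⟩
    refine ⟨x + d, ?_⟩
    simp only [Set.mem_iInter] at hx ⊢
    intro j hj
    rw [facet_aux N k0 d]
    exact hx j hj

theorem Cm_aux {n m : ℕ} (N : Fin m → Fin n → ℝ) (k0 : Fin m → ℝ) (d : Fin n → ℝ)
    (hcpt : IsCompact (PolyDelta N k0)) (hint : (interior (PolyDelta N k0)).Nonempty) :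
    Cm (PolyDelta N (fun j => k0 j + dot d (N j))) = Cm (PolyDelta N k0) + d := by
  have hpre : (fun x => x + d) ⁻¹' (PolyDelta N (fun j => k0 j + dot d (N j)))
      = PolyDelta N k0 := by
    ext x; simp [PolyDelta, dot_add_aux]
  have h1 := (measurePreserving_add_right (volume : Measure (Fin n → ℝ)) d).setIntegral_preimage_emb
    (measurableEmbedding_addRight d) (fun _ => (1:ℝ))
    (PolyDelta N (fun j => k0 j + dot d (N j)))
  have h2 := (measurePreserving_add_right (volume : Measure (Fin n → ℝ)) d).setIntegral_preimage_emb
    (measurableEmbedding_addRight d) (fun x => x)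
    (PolyDelta N (fun j => k0 j + dot d (N j)))
  rw [hpre] at h1 h2
  have hfin : volume (PolyDelta N k0) ≠ ⊤ := hcpt.measure_lt_top.ne
  have hpos : volume (PolyDelta N k0) ≠ 0 :=
    (Measure.measure_pos_of_nonempty_interior volume hint).ne'
  have hreal : volume.real (PolyDelta N k0) ≠ 0 := by
    simp [Measure.real, ENNReal.toReal_eq_zero_iff, hfin, hpos]
  rw [integral_add (f := fun x : Fin n → ℝ => x) (continuous_id.continuousOn.integrableOn_compact hcpt)
    (integrableOn_const hfin)] at h2
  unfold Cm
  rw [← h1, ← h2, smul_add]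
  congr 1
  simp [smul_smul, hreal]

theorem stmt10 {n m : ℕ} (N : Fin m → Fin n → ℝ) (k0 : Fin m → ℝ)
    (hcpt : IsCompact (PolyDelta N k0)) (hint : (interior (PolyDelta N k0)).Nonempty)
    (b : Fin n → ℝ) (R : Fin m → ℝ) (C : ℝ)
    (hml : ∀ k ∈ chamber N k0,
      dot (Cm (PolyDelta N k)) b = (∑ j, R j * k j) + C)
    (k : Fin m → ℝ) (hk : k ∈ chamber N k0)
    (hk1 : (fun j => k j + 1) ∈ chamber N k0)
    (d : Fin n → ℝ)
    (hd : d = Cm (PolyDelta N (fun j => k j + 1)) - Cm (PolyDelta N k)) :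
    dot d b = (∑ j, R j) ∧ (∑ j, R j * dot d (N j)) = ∑ j, R j := by
  have h1 : dot d b = ∑ j, R j := by
    have e : Cm (PolyDelta N (fun j => k j + 1)) = Cm (PolyDelta N k) + d := by
      rw [hd]; abel
    have a := hml _ hk
    have c := hml _ hk1
    rw [e, dot_add_aux, a] at c
    simp only [mul_add, Finset.sum_add_distrib, mul_one] at c
    linarith
  refine ⟨h1, ?_⟩
  have a := hml k0 (fun _ => Iff.rfl)
  have c := hml _ (chamber_aux N k0 d)
  rw [Cm_aux N k0 d hcpt hint, dot_add_aux, a] at c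
  simp only [mul_add, Finset.sum_add_distrib] at c
  linarith
end
end

section
/- Let r be a positive integer, let n_1 = (−1,0), n_2 = (0,−1), n_3 = (0,1), n_4 = (1,r) in ℝ², and let Δ = Δ(k⁰) with k⁰ = (0, 0, λ, τ) where λ > 0 and τ − rλ > 0 (so Δ is the trapezium with vertices (0,0), (0,λ), (τ,0), (τ−rλ,λ)). For b = (b_1, b_2) ∈ ℤ², the pair (Δ, b) is mass linear if and only if r b_1 = 2 b_2; moreover, if r b_1 = 2 b_2, then ⟨Cm(Δ(k)), b⟩ = −(b_1/2) k_1 + (b_1/2) k_4 for all k ∈ C_Δ (in particular the coefficients R_j satisfy ∑_j R_j = 0). -/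
open MeasureTheory

noncomputable section

abbrev NN (r : ℕ) : Fin 4 → Fin 2 → ℝ := ![![-1, 0], ![0, -1], ![0, 1], ![1, (r : ℝ)]]

lemma mem_poly (r : ℕ) (k : Fin 4 → ℝ) (x : Fin 2 → ℝ) :
    x ∈ PolyDelta (NN r) k ↔ -k 0 ≤ x 0 ∧ -k 1 ≤ x 1 ∧ x 1 ≤ k 2 ∧ x 0 + r * x 1 ≤ k 3 := by
  simp only [PolyDelta, dot, Set.mem_ofPred_eq, Fin.forall_fin_succ, Fin.sum_univ_two]
  simp [NN]
  constructor
  · rintro ⟨a, b, c, d⟩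
    refine ⟨by linarith, by linarith, by linarith, by linarith⟩
  · rintro ⟨a, b, c, d⟩
    refine ⟨by linarith, by linarith, by linarith, by linarith⟩

lemma facet0 (r : ℕ) (k : Fin 4 → ℝ) (x : Fin 2 → ℝ) :
    x ∈ PolyFacet (NN r) k 0 ↔ x ∈ PolyDelta (NN r) k ∧ x 0 = -k 0 := by
  simp [PolyFacet, dot, NN]
  intro _
  constructor <;> intro h <;> linarith

lemma facet1 (r : ℕ) (k : Fin 4 → ℝ) (x : Fin 2 → ℝ) :
    x ∈ PolyFacet (NN r) k 1 ↔ x ∈ PolyDelta (NN r) k ∧ x 1 = -k 1 := by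
  simp [PolyFacet, dot, NN]
  intro _
  constructor <;> intro h <;> linarith

lemma facet2 (r : ℕ) (k : Fin 4 → ℝ) (x : Fin 2 → ℝ) :
    x ∈ PolyFacet (NN r) k 2 ↔ x ∈ PolyDelta (NN r) k ∧ x 1 = k 2 := by
  simp [PolyFacet, dot, NN]

lemma facet3 (r : ℕ) (k : Fin 4 → ℝ) (x : Fin 2 → ℝ) :
    x ∈ PolyFacet (NN r) k 3 ↔ x ∈ PolyDelta (NN r) k ∧ x 0 + r * x 1 = k 3 := by
  simp [PolyFacet, dot, NN, mul_comm]

lemma inter_iff (r : ℕ) (k : Fin 4 → ℝ) (h1 : 0 < k 1 + k 2) (h2 : 0 < k 0 + k 3 - r * k 2)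
    (J : Finset (Fin 4)) :
    (⋂ j ∈ J, PolyFacet (NN r) k j).Nonempty ↔ ¬ (1 ∈ J ∧ 2 ∈ J) ∧ ¬ (0 ∈ J ∧ 3 ∈ J) := by
  have hr : (0:ℝ) ≤ r := Nat.cast_nonneg r
  have h3 : (r:ℝ) * (-k 1) ≤ r * k 2 := mul_le_mul_of_nonneg_left (by linarith) hr
  constructor
  · rintro ⟨x, hx⟩
    simp only [Set.mem_iInter] at hx
    refine ⟨fun ⟨a, b⟩ => ?_, fun ⟨a, b⟩ => ?_⟩
    · have := (facet1 r k x).1 (hx 1 a)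
      have := (facet2 r k x).1 (hx 2 b)
      linarith
    · have := (facet0 r k x).1 (hx 0 a)
      obtain ⟨p, q⟩ := (facet3 r k x).1 (hx 3 b)
      have h4 := (mem_poly r k x).1 p
      have : (r:ℝ) * x 1 ≤ r * k 2 := mul_le_mul_of_nonneg_left (by linarith) hr
      linarith
  · rintro ⟨hA, hB⟩
    let y : ℝ := if 1 ∈ J then -k 1 else k 2
    let x : ℝ := if 0 ∈ J then -k 0 else k 3 - r * y
    have hP : (![x, y] : Fin 2 → ℝ) ∈ PolyDelta (NN r) k := by
      rw [mem_poly]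
      simp only [Matrix.cons_val_zero, Matrix.cons_val_one, x, y]
      split_ifs <;> refine ⟨?_, ?_, ?_, ?_⟩ <;> linarith
    refine ⟨![x, y], ?_⟩
    simp only [Set.mem_iInter]
    intro j hj
    fin_cases j
    · exact (facet0 r k _).2 ⟨hP, by simp at hj; simp [x, hj]⟩
    · exact (facet1 r k _).2 ⟨hP, by simp at hj; simp [y, hj]⟩
    · have : 1 ∉ J := fun h => hA ⟨h, hj⟩
      exact (facet2 r k _).2 ⟨hP, by simp [y, this]⟩
    · have : 0 ∉ J := fun h => hB ⟨h, hj⟩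
      exact (facet3 r k _).2 ⟨hP, by simp [x, this]⟩

lemma chamber_iff (r : ℕ) (L T : ℝ) (hL : 0 < L) (hT : 0 < T - (r : ℝ) * L) (k : Fin 4 → ℝ) :
    k ∈ chamber (NN r) ![0, 0, L, T] ↔ 0 < k 1 + k 2 ∧ 0 < k 0 + k 3 - r * k 2 := by
  have h0 := inter_iff r ![0, 0, L, T] (by simpa using hL) (by simpa using hT)
  constructor
  · intro hk
    have hk' : ∀ J : Finset (Fin 4), (⋂ j ∈ J, PolyFacet (NN r) k j).Nonempty ↔
        ¬ (1 ∈ J ∧ 2 ∈ J) ∧ ¬ (0 ∈ J ∧ 3 ∈ J) := fun J => (hk J).trans (h0 J)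
    obtain ⟨u, hu⟩ := (hk' {0, 1}).2 (by decide)
    obtain ⟨v, hv⟩ := (hk' {0, 2}).2 (by decide)
    have n1 : ¬ _ := fun h => absurd ((hk' {1, 2}).1 h) (by decide)
    have n2 : ¬ _ := fun h => absurd ((hk' {0, 3}).1 h) (by decide)
    simp only [Finset.mem_insert, Finset.mem_singleton, Set.iInter_iInter_eq_or_left,
      Set.iInter_iInter_eq_left, Set.mem_inter_iff, facet0, facet1, facet2] at hu hv
    have pu := (mem_poly r k u).1 hu.1.1
    have pv := (mem_poly r k v).1 hv.1.1
    obtain ⟨⟨hu0, hu1⟩, -, hu2⟩ := hu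
    obtain ⟨⟨hv0, hv1⟩, -, hv2⟩ := hv
    constructor
    · by_contra hc
      apply n1
      refine ⟨u, ?_⟩
      simp only [Finset.mem_insert, Finset.mem_singleton, Set.iInter_iInter_eq_or_left,
        Set.iInter_iInter_eq_left, Set.mem_inter_iff, facet1, facet2]
      exact ⟨⟨hu0, hu2⟩, hu0, by linarith⟩
    · by_contra hc
      apply n2
      refine ⟨v, ?_⟩
      simp only [Finset.mem_insert, Finset.mem_singleton, Set.iInter_iInter_eq_or_left,
        Set.iInter_iInter_eq_left, Set.mem_inter_iff, facet0, facet3]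
      refine ⟨⟨hv0, hv1⟩, hv0, ?_⟩
      have h4 := pv.2.2.2
      rw [hv2] at h4 ⊢
      linarith
  · rintro ⟨h1, h2⟩ J
    exact (inter_iff r k h1 h2 J).trans (h0 J).symm

lemma poly_compact (r : ℕ) (k : Fin 4 → ℝ) : IsCompact (PolyDelta (NN r) k) := by
  have hr : (0:ℝ) ≤ r := Nat.cast_nonneg r
  apply IsCompact.of_isClosed_subset
    (isCompact_Icc (a := (![-k 0, -k 1] : Fin 2 → ℝ)) (b := ![k 3 + r * k 1, k 2]))
  · have : PolyDelta (NN r) k = {x | -k 0 ≤ x 0 ∧ -k 1 ≤ x 1 ∧ x 1 ≤ k 2 ∧ x 0 + r * x 1 ≤ k 3} := by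
      ext x; exact mem_poly r k x
    rw [this]
    refine IsClosed.and (isClosed_le (by fun_prop) (by fun_prop)) <|
      IsClosed.and (isClosed_le (by fun_prop) (by fun_prop)) <|
      IsClosed.and (isClosed_le (by fun_prop) (by fun_prop))
      (isClosed_le (by fun_prop) (by fun_prop))
  · intro x hx
    rw [mem_poly] at hx
    obtain ⟨a, b, c, d⟩ := hx
    have : (r:ℝ) * (-k 1) ≤ r * x 1 := mul_le_mul_of_nonneg_left (by linarith) hr
    rw [Set.mem_Icc, Pi.le_def, Pi.le_def]
    simp [Fin.forall_fin_two]
    refine ⟨⟨?_, ?_⟩, ?_, ?_⟩ <;> linarith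

lemma int_formula (r : ℕ) (k : Fin 4 → ℝ) (h1 : 0 < k 1 + k 2) (h2 : 0 < k 0 + k 3 - r * k 2)
    (f : ℝ → ℝ → ℝ) (hf : Continuous (fun p : ℝ × ℝ => f p.1 p.2)) :
    ∫ x in PolyDelta (NN r) k, f (x 0) (x 1) =
      ∫ y in (-k 1)..(k 2), ∫ x in (-k 0)..(k 3 - r * y), f x y := by
  have hr : (0:ℝ) ≤ r := Nat.cast_nonneg r
  have hc := poly_compact r k
  have hm : MeasurableSet (PolyDelta (NN r) k) := hc.isClosed.measurableSet
  set S : Set (ℝ × ℝ) := (MeasurableEquiv.finTwoArrow (α := ℝ)).symm ⁻¹' (PolyDelta (NN r) k) with hS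
  have hSm : MeasurableSet S := (MeasurableEquiv.finTwoArrow (α := ℝ)).symm.measurable hm
  have mp := (volume_preserving_finTwoArrow ℝ).symm
  have hmem : ∀ x y : ℝ, (x, y) ∈ S ↔ -k 0 ≤ x ∧ -k 1 ≤ y ∧ y ≤ k 2 ∧ x + r * y ≤ k 3 := by
    intro x y
    rw [hS, Set.mem_preimage, mem_poly]
    rfl
  have e1 : ∫ x in PolyDelta (NN r) k, f (x 0) (x 1) = ∫ p in S, f p.1 p.2 := by
    rw [← mp.setIntegral_preimage_emb (MeasurableEquiv.measurableEmbedding _)]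
    rfl
  have hfi : IntegrableOn (fun p : ℝ × ℝ => f p.1 p.2) S := by
    have : IntegrableOn (fun x : Fin 2 → ℝ => f (x 0) (x 1)) (PolyDelta (NN r) k) := by
      apply ContinuousOn.integrableOn_compact hc
      exact (hf.comp (by fun_prop : Continuous (fun x : Fin 2 → ℝ => (x 0, x 1)))).continuousOn
    exact (mp.integrableOn_comp_preimage (MeasurableEquiv.measurableEmbedding _)).2 this
  rw [e1, ← integral_indicator hSm, Measure.volume_eq_prod, integral_prod_symm _
    ((integrable_indicator_iff hSm).2 hfi), intervalIntegral.integral_of_le (by linarith),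
    ← integral_Icc_eq_integral_Ioc, ← integral_indicator measurableSet_Icc]
  congr 1
  ext y
  by_cases hy : y ∈ Set.Icc (-k 1) (k 2)
  · have h4 : (r:ℝ) * y ≤ r * k 2 := mul_le_mul_of_nonneg_left hy.2 hr
    rw [Set.indicator_of_mem hy, intervalIntegral.integral_of_le (by linarith),
      ← integral_Icc_eq_integral_Ioc, ← integral_indicator measurableSet_Icc]
    congr 1
    ext x
    have : (x, y) ∈ S ↔ x ∈ Set.Icc (-k 0) (k 3 - r * y) := by
      rw [hmem, Set.mem_Icc]
      constructor
      · rintro ⟨a, b, c, d⟩; exact ⟨a, by linarith⟩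
      · rintro ⟨a, b⟩; exact ⟨a, hy.1, hy.2, by linarith⟩
    by_cases hx : (x, y) ∈ S
    · rw [Set.indicator_of_mem hx, Set.indicator_of_mem (this.1 hx)]
    · rw [Set.indicator_of_notMem hx, Set.indicator_of_notMem (fun h => hx (this.2 h))]
  · rw [Set.indicator_of_notMem hy]
    convert integral_zero ℝ ℝ using 2
    ext x
    apply Set.indicator_of_notMem
    rw [hmem]
    exact fun h => hy ⟨h.2.1, h.2.2.1⟩

lemma poly_int (a b c0 c1 c2 : ℝ) : ∫ y in a..b, (c0 + c1 * y + c2 * y ^ 2) =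
    c0 * (b - a) + c1 * ((b ^ 2 - a ^ 2) / 2) + c2 * ((b ^ 3 - a ^ 3) / 3) := by
  rw [intervalIntegral.integral_add, intervalIntegral.integral_add]
  · have e : ∫ y in a..b, c1 * y = c1 * ((b ^ 2 - a ^ 2) / 2) := by
      rw [intervalIntegral.integral_const_mul, integral_id]
    rw [e]
    simp [integral_pow]
    ring
  all_goals exact Continuous.intervalIntegrable (by fun_prop) _ _

lemma main_formula (r : ℕ) (k : Fin 4 → ℝ) (h1 : 0 < k 1 + k 2) (h2 : 0 < k 0 + k 3 - r * k 2)
    (b : Fin 2 → ℝ) :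
    0 < (k 0 + k 3) * (k 1 + k 2) - r * ((k 2 ^ 2 - k 1 ^ 2) / 2) ∧
    dot (Cm (PolyDelta (NN r) k)) b =
     ((k 0 + k 3) * (k 1 + k 2) - r * ((k 2 ^ 2 - k 1 ^ 2) / 2))⁻¹ *
     ((k 3 - k 0) * b 0 / 2 * ((k 0 + k 3) * (k 1 + k 2) - r * ((k 2 ^ 2 - k 1 ^ 2) / 2)) +
      (b 1 - r * b 0 / 2) *
      ((k 0 + k 3) * ((k 2 ^ 2 - k 1 ^ 2) / 2) - r * ((k 2 ^ 3 + k 1 ^ 3) / 3))) := by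
  have hr : (0:ℝ) ≤ r := Nat.cast_nonneg r
  constructor
  · have : (k 0 + k 3) * (k 1 + k 2) - r * ((k 2 ^ 2 - k 1 ^ 2) / 2) =
      (k 1 + k 2) * (k 0 + k 3 - r * k 2) + r * (k 1 + k 2) ^ 2 / 2 := by ring
    rw [this]
    positivity
  have hid : IntegrableOn (fun x : Fin 2 → ℝ => x) (PolyDelta (NN r) k) :=
    ContinuousOn.integrableOn_compact (poly_compact r k) continuousOn_id
  have hi : ∀ i, (∫ x in PolyDelta (NN r) k, x) i = ∫ x in PolyDelta (NN r) k, x i := by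
    intro i
    exact ((ContinuousLinearMap.proj (R := ℝ) (φ := fun _ : Fin 2 => ℝ) i).integral_comp_comm hid).symm
  have i0 := int_formula r k h1 h2 (fun _ _ => 1) (by fun_prop)
  have i1 := int_formula r k h1 h2 (fun x _ => x) (by fun_prop)
  have i2 := int_formula r k h1 h2 (fun _ y => y) (by fun_prop)
  have j0 : ∀ y : ℝ, (∫ x in (-k 0)..(k 3 - r * y), (1:ℝ)) = (k 0 + k 3) + (-r) * y + 0 * y ^ 2 := by
    intro y; simp; ring
  have j1 : ∀ y : ℝ, (∫ x in (-k 0)..(k 3 - r * y), x) =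
      (k 3 ^ 2 - k 0 ^ 2) / 2 + (-r * k 3) * y + (r ^ 2 / 2) * y ^ 2 := by
    intro y; rw [integral_id]; ring
  have j2 : ∀ y : ℝ, (∫ x in (-k 0)..(k 3 - r * y), y) = 0 + (k 0 + k 3) * y + (-r) * y ^ 2 := by
    intro y; simp; ring
  simp only [j0, j1, j2, poly_int] at i0 i1 i2
  simp only [dot, Cm, Fin.sum_univ_two, Pi.smul_apply, smul_eq_mul, hi]
  rw [i0, i1, i2]
  have : (k 0 + k 3) * (k 2 - -k 1) + -r * ((k 2 ^ 2 - (-k 1) ^ 2) / 2) + 0 * ((k 2 ^ 3 - (-k 1) ^ 3) / 3) = (k 0 + k 3) * (k 1 + k 2) - r * ((k 2 ^ 2 - k 1 ^ 2) / 2) := by ring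
  rw [this]
  ring

theorem stmt13 (r : ℕ) (hr : 0 < r) (L T : ℝ) (hL : 0 < L) (hT : 0 < T - (r : ℝ) * L)
    (b : Fin 2 → ℤ) :
    (IsMassLinear ![![-1, 0], ![0, -1], ![0, 1], ![1, (r : ℝ)]] ![0, 0, L, T]
        (fun i => (b i : ℝ)) ↔ (r : ℤ) * b 0 = 2 * b 1) ∧
    ((r : ℤ) * b 0 = 2 * b 1 →
      ∀ k ∈ chamber ![![-1, 0], ![0, -1], ![0, 1], ![1, (r : ℝ)]] ![0, 0, L, T],
        dot (Cm (PolyDelta ![![-1, 0], ![0, -1], ![0, 1], ![1, (r : ℝ)]] k))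
            (fun i => (b i : ℝ)) =
          -((b 0 : ℝ) / 2) * k 0 + ((b 0 : ℝ) / 2) * k 3) := by
  have hr' : (0:ℝ) < r := Nat.cast_pos.2 hr
  have key : (r : ℤ) * b 0 = 2 * b 1 →
      ∀ k ∈ chamber (NN r) ![0, 0, L, T],
        dot (Cm (PolyDelta (NN r) k)) (fun i => (b i : ℝ)) =
          -((b 0 : ℝ) / 2) * k 0 + ((b 0 : ℝ) / 2) * k 3 := by
    intro hb k hk
    obtain ⟨h1, h2⟩ := (chamber_iff r L T hL hT k).1 hk
    obtain ⟨hV, h⟩ := main_formula r k h1 h2 (fun i => (b i : ℝ))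
    have hb' : (r : ℝ) * b 0 = 2 * b 1 := by exact_mod_cast hb
    have : (b 1 : ℝ) - r * b 0 / 2 = 0 := by linarith
    rw [h, this, zero_mul, add_zero, mul_comm, mul_assoc, mul_inv_cancel₀ hV.ne']
    ring
  refine ⟨⟨?_, fun hb => ?_⟩, key⟩
  · rintro ⟨R, C, h⟩
    have P : ∀ c : ℝ, 1 < c → (b 0 : ℝ) * (r * c) / 2 +
        ((b 1 : ℝ) - r * b 0 / 2) * ((3 * c - 2) / (3 * (2 * c - 1))) =
        R 2 + R 3 * (r * c) + C := by
      intro c hc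
      have h1 : 0 < (![0, 0, 1, r * c] : Fin 4 → ℝ) 1 + (![0, 0, 1, r * c] : Fin 4 → ℝ) 2 := by simp
      have h2 : 0 < (![0, 0, 1, r * c] : Fin 4 → ℝ) 0 + (![0, 0, 1, r * c] : Fin 4 → ℝ) 3
          - r * (![0, 0, 1, r * c] : Fin 4 → ℝ) 2 := by
        simp; nlinarith
      have e := h _ ((chamber_iff r L T hL hT _).2 ⟨h1, h2⟩)
      obtain ⟨hV, e2⟩ := main_formula r _ h1 h2 (fun i => (b i : ℝ))
      rw [e2] at e
      simp [Fin.sum_univ_four] at e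
      rw [← e]
      obtain ⟨D, hD, rfl⟩ : ∃ D : ℝ, 0 < D ∧ c = (D + 1) / 2 :=
        ⟨2 * c - 1, by linarith, by ring⟩
      have a1 : (r:ℝ) * ((D + 1) / 2) - r * 2⁻¹ = r * D / 2 := by ring
      have a2 : 2 * ((D + 1) / 2) - 1 = D := by ring
      rw [a1, a2]
      field_simp
    have p2 := P 2 (by norm_num)
    have p3 := P 3 (by norm_num)
    have p4 := P 4 (by norm_num)
    have : (r : ℝ) * b 0 = 2 * b 1 := by
      norm_num at p2 p3 p4
      linarith
    exact_mod_cast this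
  · refine ⟨![-((b 0 : ℝ) / 2), 0, 0, (b 0 : ℝ) / 2], 0, fun k hk => ?_⟩
    rw [key hb k hk]
    simp [Fin.sum_univ_four]
end
end
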